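/- Let n ∈ ℕ, m ≥ 1 an integer, and g, h : 𝔽₂ⁿ → 𝔽₂. Let f(x) = g(x) ⊕ h(x). Then for all u ∈ 𝔽₂ⁿ, H^(m)_f(u) = 2^(-n/2) · ∑_{v ∈ 𝔽₂ⁿ} H^(m)_g(v) · W_h(u ⊕ v), and also H^(m)_f(u) = 2^(-n/2) · ∑_{v ∈ 𝔽₂ⁿ} W_g(v) · H^(m)_h(u ⊕ v). -/

import Mathlib

open Finset

noncomputable section

/-- Sign character: `(-1)^v ∈ ℂ` for `v ∈ 𝔽₂`. -/
def sgn (v : ZMod 2) : ℂ := if v = 0 then 1 else -1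

/-- Hamming weight of `x ∈ 𝔽₂ⁿ`. -/
def wt {n : ℕ} (x : Fin n → ZMod 2) : ℕ := (Finset.univ.filter (fun i => x i = 1)).card

/-- Dot product `x·y = ⊕ᵢ xᵢyᵢ ∈ 𝔽₂`. -/
def dotp {n : ℕ} (x y : Fin n → ZMod 2) : ZMod 2 := ∑ i, x i * y i

/-- `x⊙y ∈ ℕ`: number of indices with `xᵢ = yᵢ = 1`. -/
def odot {n : ℕ} (x y : Fin n → ZMod 2) : ℕ :=
  (Finset.univ.filter (fun i => x i = 1 ∧ y i = 1)).card

/-- `ζ_m = exp(2πi/m)`. -/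
def zeta (m : ℕ) : ℂ := Complex.exp (2 * Real.pi * Complex.I / m)

/-- The `m`-Hadamard transform of `f` at `ω`. -/
def mHad (m : ℕ) {n : ℕ} (f : (Fin n → ZMod 2) → ZMod 2) (ω : Fin n → ZMod 2) : ℂ :=
  ((Real.sqrt 2 : ℂ) ^ n)⁻¹ *
    ∑ x : Fin n → ZMod 2, sgn (f x + dotp x ω) * zeta m ^ wt x

/-- The `m`-crosscorrelation of `f` and `g` at `y`. -/
def mCross (m : ℕ) {n : ℕ} (f g : (Fin n → ZMod 2) → ZMod 2) (y : Fin n → ZMod 2) : ℂ :=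
  ∑ x : Fin n → ZMod 2, sgn (f x + g (x + y)) * (zeta m ^ 2) ^ odot x y

/-- The (3-fold) `m`-Forrelation of `f₁, f₂, f₃`. -/
def mForr (m : ℕ) {n : ℕ} (f₁ f₂ f₃ : (Fin n → ZMod 2) → ZMod 2) : ℂ :=
  ((2 : ℂ) ^ n)⁻¹ *
    ∑ x : Fin n → ZMod 2, sgn (f₁ x) * mHad m f₂ x * (starRingEnd ℂ) (mHad m f₃ x)

/-- The Walsh–Hadamard transform of `f` at `ω`. -/
def walsh {n : ℕ} (f : (Fin n → ZMod 2) → ZMod 2) (ω : Fin n → ZMod 2) : ℂ :=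
  ((Real.sqrt 2 : ℂ) ^ n)⁻¹ * ∑ x : Fin n → ZMod 2, sgn (f x + dotp x ω)

/-- The nega-Hadamard transform of `f` at `ω`. -/
def negaHad {n : ℕ} (f : (Fin n → ZMod 2) → ZMod 2) (ω : Fin n → ZMod 2) : ℂ :=
  ((Real.sqrt 2 : ℂ) ^ n)⁻¹ *
    ∑ x : Fin n → ZMod 2, sgn (f x + dotp x ω) * Complex.I ^ wt x

/-- The elementary symmetric quadratic Boolean function `s₂`. -/
def s2 {n : ℕ} (x : Fin n → ZMod 2) : ZMod 2 :=
  ∑ i : Fin n, ∑ j ∈ Finset.univ.filter (fun j => i < j), x i * x j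

/-- The linear function `L_u(x) = ⊕ᵢ xᵢ · (⊕_{j ≠ i} uⱼ)`. -/
def Lfun {n : ℕ} (u x : Fin n → ZMod 2) : ZMod 2 :=
  ∑ i : Fin n, x i * ∑ j ∈ Finset.univ.filter (fun j => j ≠ i), u j

end

lemma sgn_add' (a b : ZMod 2) : sgn (a + b) = sgn a * sgn b := by
  have h01 : ∀ a : ZMod 2, a = 0 ∨ a = 1 := by decide
  have h11 : (1 : ZMod 2) + 1 = 0 := by decide
  rcases h01 a with rfl | rfl <;> rcases h01 b with rfl | rfl <;> simp [sgn, h11]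

lemma sgn_sum' {n : ℕ} (a : Fin n → ZMod 2) : sgn (∑ i, a i) = ∏ i, sgn (a i) := by
  let φ : Multiplicative (ZMod 2) →* ℂ :=
    { toFun := fun a => sgn a.toAdd
      map_one' := by simp [sgn]
      map_mul' := fun a b => sgn_add' _ _ }
  have := map_prod φ (fun i => Multiplicative.ofAdd (a i)) Finset.univ
  simpa [φ, ← ofAdd_sum] using this

lemma dotp_add_right' {n : ℕ} (x u v : Fin n → ZMod 2) :
    dotp x (u + v) = dotp x u + dotp x v := by
  simp [dotp, mul_add, Finset.sum_add_distrib]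

lemma sgn_orth {n : ℕ} (x y : Fin n → ZMod 2) :
    ∑ v : Fin n → ZMod 2, sgn (dotp x v) * sgn (dotp y v) = if x = y then (2 : ℂ) ^ n else 0 := by
  have h1 : ∀ v : Fin n → ZMod 2, sgn (dotp x v) * sgn (dotp y v)
      = ∏ i, (sgn (x i * v i) * sgn (y i * v i)) := by
    intro v
    rw [dotp, dotp, sgn_sum', sgn_sum', Finset.prod_mul_distrib]
  have h2 : ∀ a b : ZMod 2, ∑ c : ZMod 2, sgn (a * c) * sgn (b * c)
      = if a = b then (2 : ℂ) else 0 := by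
    intro a b
    have : ∀ F : ZMod 2 → ℂ, ∑ c, F c = F 0 + F 1 := fun F => Fin.sum_univ_two F
    rw [this]
    have h01 : ∀ a : ZMod 2, a = 0 ∨ a = 1 := by decide
    rcases h01 a with rfl | rfl <;> rcases h01 b with rfl | rfl <;> simp [sgn] <;> norm_num
  simp_rw [h1]
  have h3 := Finset.prod_univ_sum (fun _ : Fin n => (Finset.univ : Finset (ZMod 2)))
    (fun i c => sgn (x i * c) * sgn (y i * c))
  rw [Fintype.piFinset_univ] at h3
  rw [← h3]
  simp_rw [h2]
  split_ifs with h
  · subst h; simp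
  · obtain ⟨i, hi⟩ := Function.ne_iff.mp h
    exact Finset.prod_eq_zero (Finset.mem_univ i) (by simp [hi])

lemma conv_key {n : ℕ} (A B : (Fin n → ZMod 2) → ℂ) (u : Fin n → ZMod 2) :
    ∑ v : Fin n → ZMod 2, (∑ x, A x * sgn (dotp x v)) * (∑ y, B y * sgn (dotp y (u + v)))
      = 2 ^ n * ∑ x, A x * B x * sgn (dotp x u) := by
  calc _ = ∑ v : Fin n → ZMod 2, ∑ x, ∑ y,
        (A x * B y * sgn (dotp y u)) * (sgn (dotp x v) * sgn (dotp y v)) := by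
        refine Finset.sum_congr rfl fun v _ => ?_
        rw [Finset.sum_mul_sum]
        refine Finset.sum_congr rfl fun x _ => Finset.sum_congr rfl fun y _ => ?_
        rw [dotp_add_right', sgn_add']; ring
    _ = ∑ x, ∑ y, (A x * B y * sgn (dotp y u)) *
        ∑ v : Fin n → ZMod 2, (sgn (dotp x v) * sgn (dotp y v)) := by
        rw [Finset.sum_comm]
        refine Finset.sum_congr rfl fun x _ => ?_
        rw [Finset.sum_comm]
        simp_rw [Finset.mul_sum]
    _ = _ := by
        simp_rw [sgn_orth, Finset.mul_sum]
        refine Finset.sum_congr rfl fun x _ => ?_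
        simp; ring

lemma mHad_eq (m : ℕ) {n : ℕ} (f : (Fin n → ZMod 2) → ZMod 2) (w : Fin n → ZMod 2) :
    mHad m f w = ((Real.sqrt 2 : ℂ) ^ n)⁻¹ *
      ∑ x, (sgn (f x) * zeta m ^ wt x) * sgn (dotp x w) := by
  rw [mHad]; congr 1
  refine Finset.sum_congr rfl fun x _ => ?_
  rw [sgn_add']; ring

lemma walsh_eq {n : ℕ} (f : (Fin n → ZMod 2) → ZMod 2) (w : Fin n → ZMod 2) :
    walsh f w = ((Real.sqrt 2 : ℂ) ^ n)⁻¹ * ∑ x, sgn (f x) * sgn (dotp x w) := by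
  rw [walsh]; congr 1
  refine Finset.sum_congr rfl fun x _ => ?_
  rw [sgn_add']

lemma conv_scaled {n : ℕ} (A B C : (Fin n → ZMod 2) → ℂ) (u : Fin n → ZMod 2)
    (hC : ∀ x, C x = A x * B x) :
    ((Real.sqrt 2 : ℂ) ^ n)⁻¹ * ∑ x, C x * sgn (dotp x u) =
    ((Real.sqrt 2 : ℂ) ^ n)⁻¹ * ∑ v : Fin n → ZMod 2,
      (((Real.sqrt 2 : ℂ) ^ n)⁻¹ * ∑ x, A x * sgn (dotp x v)) *
      (((Real.sqrt 2 : ℂ) ^ n)⁻¹ * ∑ y, B y * sgn (dotp y (u + v))) := by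
  have hs : ((Real.sqrt 2 : ℂ) ^ n)⁻¹ * ((Real.sqrt 2 : ℂ) ^ n)⁻¹ * 2 ^ n = 1 := by
    have h2 : (Real.sqrt 2 : ℂ) * Real.sqrt 2 = 2 := by
      rw [← Complex.ofReal_mul, Real.mul_self_sqrt (by norm_num)]; norm_num
    rw [← mul_inv, ← mul_pow, h2]
    exact inv_mul_cancel₀ (pow_ne_zero _ two_ne_zero)
  simp_rw [hC, mul_mul_mul_comm (((Real.sqrt 2 : ℂ) ^ n)⁻¹)]
  rw [← Finset.mul_sum, conv_key, ← mul_assoc (_ * _) (2 ^ n), hs, one_mul]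

theorem stmt17 (n m : ℕ) (hm : 1 ≤ m) (f g h : (Fin n → ZMod 2) → ZMod 2)
    (hf : ∀ x, f x = g x + h x) :
    (∀ u, mHad m f u =
        ((Real.sqrt 2 : ℂ) ^ n)⁻¹ *
          ∑ v : Fin n → ZMod 2, mHad m g v * walsh h (u + v)) ∧
      (∀ u, mHad m f u =
        ((Real.sqrt 2 : ℂ) ^ n)⁻¹ *
          ∑ v : Fin n → ZMod 2, walsh g v * mHad m h (u + v)) := by
  refine ⟨fun u => ?_, fun u => ?_⟩
  · simp_rw [mHad_eq, walsh_eq]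
    exact conv_scaled _ _ _ u fun x => by rw [hf, sgn_add']; ring
  · simp_rw [mHad_eq, walsh_eq]
    exact conv_scaled _ _ _ u fun x => by rw [hf, sgn_add']; ring
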